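/- If a circuit (n,m,f) is Voronoi feasible, then it has a Voronoi solution B which is injective when restricted to Σ^m. -/

import Mathlib

open Finset Matrix

def IsSpin {d : ℕ} (s : Fin d → ℝ) : Prop := ∀ i, s i = -1 ∨ s i = 1

/-- The Euclidean norm on `Fin n → ℝ`. -/
noncomputable def euclNorm {n : ℕ} (v : Fin n → ℝ) : ℝ := Real.sqrt (∑ i, (v i) ^ 2)

/-- `B(y) = T y + b` is a Voronoi solution for the circuit `(n,m,f)`: every spin input `x`
is strictly closer (in Euclidean norm) to `B (f x)` than to `B y` for every spin `y ≠ f x`. -/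
def VoronoiSolution {n m : ℕ} (f : (Fin n → ℝ) → (Fin m → ℝ))
    (T : Matrix (Fin n) (Fin m) ℝ) (b : Fin n → ℝ) : Prop :=
  ∀ x, IsSpin x → ∀ y, IsSpin y → y ≠ f x →
    euclNorm (x - (T.mulVec (f x) + b)) < euclNorm (x - (T.mulVec y + b))

open Filter Topology

theorem finite_setOf_isSpin (d : ℕ) : {s : Fin d → ℝ | IsSpin s}.Finite := by
  refine (Set.Finite.pi (t := fun _ : Fin d => ({-1, 1} : Set ℝ))
    fun _ => Set.toFinite _).subset ?_
  intro s hs i _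
  exact hs i

theorem continuous_euclNorm {n : ℕ} : Continuous (euclNorm (n := n)) := by
  unfold euclNorm
  fun_prop

/-- A continuous deformation of the linear part preserves Voronoi solutions for small parameters. -/
theorem VoronoiSolution.eventually {n m : ℕ} {f : (Fin n → ℝ) → (Fin m → ℝ)}
    {T : ℝ → Matrix (Fin n) (Fin m) ℝ} {b : Fin n → ℝ} (hT : Continuous T)
    (h : VoronoiSolution f (T 0) b) : ∀ᶠ ε in 𝓝 (0 : ℝ), VoronoiSolution f (T ε) b := by
  have hcont (x : Fin n → ℝ) (y : Fin m → ℝ) :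
      Continuous fun ε => euclNorm (x - ((T ε).mulVec y + b)) :=
    continuous_euclNorm.comp
      (continuous_const.sub ((hT.matrix_mulVec continuous_const).add continuous_const))
  refine (eventually_all_finite (finite_setOf_isSpin n)).2 fun x hx =>
    (eventually_all_finite (finite_setOf_isSpin m)).2 fun y hy => ?_
  by_cases hxy : y = f x
  · exact Eventually.of_forall fun _ hne => absurd hxy hne
  · exact ((hcont x (f x)).continuousAt.eventually_lt (hcont x y).continuousAt
      (h x hx y hy hxy)).mono fun _ hlt _ => hlt

/-- A perturbation of a linear form by `∑ ε ^ (j + 1) v j` separates distinct vectors. -/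
theorem eventually_sum_add_pow_mul_ne {m : ℕ} (t : Fin m → ℝ) {y z : Fin m → ℝ} (hyz : y ≠ z) :
    ∀ᶠ ε : ℝ in 𝓝[≠] 0,
      ∑ j, (t j + ε ^ (j.val + 1)) * y j ≠ ∑ j, (t j + ε ^ (j.val + 1)) * z j := by
  let p : Polynomial ℝ := ∑ j : Fin m,
    (Polynomial.C (t j) + Polynomial.X ^ (j.val + 1)) * Polynomial.C (y j - z j)
  have hp : p ≠ 0 := by
    obtain ⟨k, hk⟩ := Function.ne_iff.1 hyz
    intro h0
    have hcoeff : p.coeff (k.val + 1) = y k - z k := by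
      simp only [p, Polynomial.finsetSum_coeff, Polynomial.coeff_mul_C, Polynomial.coeff_add,
        Polynomial.coeff_C_succ, Polynomial.coeff_X_pow, zero_add, ite_mul, one_mul, zero_mul]
      rw [Finset.sum_eq_single k]
      · simp
      · intro j _ hj
        have : k.val ≠ j.val := fun h => hj (Fin.ext h.symm)
        simp [this]
      · simp
    rw [h0, Polynomial.coeff_zero] at hcoeff
    exact hk (sub_eq_zero.1 hcoeff.symm)
  have hfin : {ε : ℝ | p.IsRoot ε}.Finite := Polynomial.finite_setOfPred_isRoot hp
  have hev : ∀ᶠ ε : ℝ in 𝓝[≠] 0, ¬ p.IsRoot ε := by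
    have hle : 𝓝[≠] (0 : ℝ) ≤ cofinite := nhdsNE_le_cofinite 0
    exact hle hfin.compl_mem_cofinite
  filter_upwards [hev] with ε hε heq
  apply hε
  simp only [p, Polynomial.IsRoot, Polynomial.eval_finsetSum, Polynomial.eval_mul,
    Polynomial.eval_add, Polynomial.eval_pow, Polynomial.eval_X, Polynomial.eval_C, mul_sub,
    Finset.sum_sub_distrib]
  exact sub_eq_zero.2 heq

/-- if `(n,m,f)` is Voronoi feasible, then it has a Voronoi solution which is
injective when restricted to `Σᵐ`. -/
theorem statement8 (n m : ℕ) (f : (Fin n → ℝ) → (Fin m → ℝ))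
    (hf : ∀ x, IsSpin x → IsSpin (f x))
    (hvf : ∃ (T : Matrix (Fin n) (Fin m) ℝ) (b : Fin n → ℝ), VoronoiSolution f T b) :
    ∃ (T : Matrix (Fin n) (Fin m) ℝ) (b : Fin n → ℝ), VoronoiSolution f T b ∧
      ∀ y z : Fin m → ℝ, IsSpin y → IsSpin z →
        T.mulVec y + b = T.mulVec z + b → y = z := by
  obtain ⟨T, b, hTb⟩ := hvf
  let S : ℝ → Matrix (Fin n) (Fin m) ℝ := fun ε => Matrix.of fun i j => T i j + ε ^ (j.val + 1)
  have hS : Continuous S := by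
    refine continuous_matrix fun i j => ?_
    simp only [S, Matrix.of_apply]
    fun_prop
  have hS0 : S 0 = T := by
    ext i j
    simp [S]
  have hsol : ∀ᶠ ε in 𝓝[≠] (0 : ℝ), VoronoiSolution f (S ε) b :=
    (VoronoiSolution.eventually hS (hS0.symm ▸ hTb)).filter_mono nhdsWithin_le_nhds
  have hinj : ∀ᶠ ε in 𝓝[≠] (0 : ℝ), ∀ y ∈ {s : Fin m → ℝ | IsSpin s},
      ∀ z ∈ {s : Fin m → ℝ | IsSpin s}, (S ε).mulVec y + b = (S ε).mulVec z + b → y = z := by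
    refine (eventually_all_finite (finite_setOf_isSpin m)).2 fun y hy =>
      (eventually_all_finite (finite_setOf_isSpin m)).2 fun z hz => ?_
    by_cases hyz : y = z
    · exact Eventually.of_forall fun _ _ => hyz
    rcases n.eq_zero_or_pos with rfl | hn
    · have hspin : IsSpin (0 : Fin 0 → ℝ) := fun i => i.elim0
      have himage (w : Fin m → ℝ) (hw : IsSpin w) : w = f 0 := by
        by_contra hne
        have hlt := hTb 0 hspin w hw hne
        simp [euclNorm] at hlt
      exact absurd ((himage y hy).trans (himage z hz).symm) hyz
    · filter_upwards [eventually_sum_add_pow_mul_ne (T ⟨0, hn⟩) hyz] with ε hε heq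
      exact absurd (congrFun (add_right_cancel heq) ⟨0, hn⟩) hε
  obtain ⟨ε, hε, hεinj⟩ := (hsol.and hinj).exists
  exact ⟨S ε, b, hε, fun y z hy hz => hεinj y hy z hz⟩
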